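/- Fix R ∈ ℝ. There exists ε₀ > 0 such that for every locally absolutely continuous ψ : ℝ → ℂ with ψ' ∈ L²_loc, ∫_ℝ W_R |ψ - φ|² dx < ∞, and inf_{α,β ∈ ℝ} ρ_R(e^{iα} ψ(· + β), φ) ≤ ε₀², there exist α, β ∈ ℝ such that, writing e^{iα} ψ(x + β) = φ(x) + u(x) + i v(x) with u, v : ℝ → ℝ, the orthogonality constraints ∫_ℝ u(x) φ'(x) dx = 0 and ∫_ℝ W_R(x) v(x) φ(x) dx = 0 hold. -/

import Mathlib

open Real MeasureTheory Set ENNReal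

noncomputable def φ (x : ℝ) : ℝ := Real.sqrt ((1 + Real.tanh x) / 2)

/-- The weight of the Hilbert space `𝓗_R`. -/
noncomputable def W (R x : ℝ) : ℝ :=
  if x ≤ R then 1 else (1 - (φ x) ^ 2) / (1 - (φ R) ^ 2)

/-- The distance `ρ_R(ψ, φ)` to the kink. -/
noncomputable def rho (R : ℝ) (ψ : ℝ → ℂ) : ℝ≥0∞ :=
  (∫⁻ x : ℝ, (‖deriv ψ x - ((deriv φ x : ℝ) : ℂ)‖₊ : ℝ≥0∞) ^ 2) +
  (∫⁻ x : ℝ, ENNReal.ofReal (W R x) * (‖ψ x - (φ x : ℂ)‖₊ : ℝ≥0∞) ^ 2) +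
  ∫⁻ x in Ioi R, ENNReal.ofReal ((‖ψ x‖ ^ 2 - (φ x) ^ 2) ^ 2)

/-! ### The kink profile -/

lemma tanh_aux (x : ℝ) : (1 + Real.tanh x) / 2 = 1 / (1 + Real.exp (-2 * x)) := by
  rw [Real.tanh_eq_sinh_div_cosh, Real.sinh_eq, Real.cosh_eq]
  have h1 : Real.exp (-2 * x) = Real.exp (-x) * Real.exp (-x) := by
    rw [← Real.exp_add]; congr 1; ring
  have h2 : Real.exp x * Real.exp (-x) = 1 := by rw [← Real.exp_add]; simp
  have := Real.exp_pos x
  have := Real.exp_pos (-x)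
  rw [h1]
  field_simp
  linear_combination (2 * Real.exp (-x)) * h2

lemma phi_sq (x : ℝ) : φ x ^ 2 = 1 / (1 + Real.exp (-2 * x)) := by
  rw [φ, tanh_aux, Real.sq_sqrt (by positivity)]

lemma phi_pos (x : ℝ) : 0 < φ x := by
  rw [φ, tanh_aux]; positivity

lemma phi_sq_lt (x : ℝ) : φ x ^ 2 < 1 := by
  rw [phi_sq, div_lt_one (by positivity)]
  linarith [Real.exp_pos (-2 * x)]

lemma phi_lt_one (x : ℝ) : φ x < 1 := by
  nlinarith [phi_sq_lt x, phi_pos x]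

lemma phi_le_exp (x : ℝ) : φ x ≤ Real.exp x := by
  refine (pow_le_pow_iff_left₀ (phi_pos x).le (Real.exp_pos x).le two_ne_zero).1 ?_
  rw [phi_sq, ← Real.exp_nat_mul, div_le_iff₀ (by positivity), mul_add, ← Real.exp_add]
  have : ((2 : ℕ) : ℝ) * x + -2 * x = 0 := by push_cast; ring
  rw [this, Real.exp_zero]
  linarith [Real.exp_pos (((2 : ℕ) : ℝ) * x)]

lemma one_sub_phi_sq_le (x : ℝ) : 1 - φ x ^ 2 ≤ Real.exp (-2 * x) := by
  rw [phi_sq]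
  have h := Real.exp_pos (-2 * x)
  rw [sub_le_iff_le_add, ← sub_le_iff_le_add', le_div_iff₀ (by positivity)]
  nlinarith

lemma hasDerivAt_phi (x : ℝ) : HasDerivAt φ (φ x * (1 - φ x ^ 2)) x := by
  have e : φ = fun x => Real.sqrt (1 / (1 + Real.exp (-2 * x))) := by
    funext y; rw [φ, tanh_aux]
  have hp := Real.exp_pos (-2 * x)
  have h1 : HasDerivAt (fun x : ℝ => 1 + Real.exp (-2 * x)) (Real.exp (-2 * x) * (-2)) x := by
    have := ((hasDerivAt_id x).const_mul (-2 : ℝ)).exp.const_add (1 : ℝ)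
    simpa using this
  have h0 : (1 + Real.exp (-2 * x)) ≠ 0 := by positivity
  have h2 := (h1.fun_inv h0).sqrt (inv_ne_zero h0)
  simp only [one_div] at e
  rw [← e] at h2
  convert h2 using 1
  have hs : Real.sqrt ((1 + Real.exp (-2 * x))⁻¹) = φ x := by rw [φ, tanh_aux, one_div]
  rw [_root_.eq_div_iff]
  · simp only [hs]
    have := phi_sq x
    have h4 : φ x * (1 - φ x ^ 2) * (2 * φ x) = 2 * φ x ^ 2 * (1 - φ x ^ 2) := by ring
    rw [h4, this]
    field_simp
    ring
  · simp only [hs]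
    have := phi_pos x
    positivity

lemma deriv_phi (x : ℝ) : deriv φ x = φ x * (1 - φ x ^ 2) := (hasDerivAt_phi x).deriv

lemma continuous_phi : Continuous φ :=
  continuous_iff_continuousAt.2 fun x => (hasDerivAt_phi x).continuousAt

lemma deriv_phi_pos (x : ℝ) : 0 < deriv φ x := by
  rw [deriv_phi]; exact mul_pos (phi_pos x) (by linarith [phi_sq_lt x])

lemma phi_strictMono : StrictMono φ := strictMono_of_deriv_pos deriv_phi_pos

lemma deriv_phi_le (x : ℝ) : deriv φ x ≤ Real.exp (-|x|) := by
  rw [deriv_phi]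
  have h1 := phi_pos x
  have h2 := phi_lt_one x
  have h3 := phi_sq_lt x
  rcases le_total x 0 with h | h
  · rw [abs_of_nonpos h, neg_neg]
    nlinarith [phi_le_exp x, sq_nonneg (φ x), mul_nonneg h1.le (sq_nonneg (φ x))]
  · rw [abs_of_nonneg h]
    have : Real.exp (-2 * x) ≤ Real.exp (-x) := Real.exp_le_exp.2 (by linarith)
    nlinarith [one_sub_phi_sq_le x]

/-! ### The weight -/

lemma W_pos (R x : ℝ) : 0 < W R x := by
  unfold W
  split_ifs
  · exact one_pos
  · exact div_pos (by linarith [phi_sq_lt x]) (by linarith [phi_sq_lt R])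

lemma measurable_W (R : ℝ) : Measurable (W R) := by
  unfold W
  have := continuous_phi.measurable
  exact Measurable.ite measurableSet_Iic measurable_const (by fun_prop)

lemma W_phi_le (R x : ℝ) :
    W R x * φ x ≤ (Real.exp |R| + 1 / (1 - φ R ^ 2)) * Real.exp (-|x|) := by
  have hR : 0 < 1 - φ R ^ 2 := by linarith [phi_sq_lt R]
  rw [add_mul]
  unfold W
  split_ifs with h
  · have : 0 ≤ 1 / (1 - φ R ^ 2) * Real.exp (-|x|) := by positivity
    have h2 : φ x ≤ Real.exp |R| * Real.exp (-|x|) := by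
      rw [← Real.exp_add]
      rcases le_total x 0 with h0 | h0
      · refine (phi_le_exp x).trans (Real.exp_le_exp.2 ?_)
        rw [abs_of_nonpos h0]; linarith [abs_nonneg R]
      · refine (phi_lt_one x).le.trans (Real.one_le_exp ?_)
        rw [abs_of_nonneg h0]; linarith [le_abs_self R]
    linarith
  · have h1 : (1 - φ x ^ 2) / (1 - φ R ^ 2) * φ x = 1 / (1 - φ R ^ 2) * deriv φ x := by
      rw [deriv_phi]; ring
    rw [h1]
    have := mul_le_mul_of_nonneg_left (deriv_phi_le x) (by positivity : 0 ≤ 1 / (1 - φ R ^ 2))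
    have : 0 ≤ Real.exp |R| * Real.exp (-|x|) := by positivity
    linarith

/-! ### Integrals against an exponentially decaying weight -/

lemma integrable_g : Integrable (fun x : ℝ => (1 + |x|) * Real.exp (-|x|)) := by
  refine (integrable_inv_one_add_sq.const_mul 27).mono'
    (by fun_prop) (Filter.Eventually.of_forall fun x => ?_)
  have hx := abs_nonneg x
  rw [Real.norm_of_nonneg (by positivity), ← div_eq_mul_inv, le_div_iff₀ (by positivity),
    Real.exp_neg, mul_assoc, mul_comm, mul_assoc, inv_mul_le_iff₀ (Real.exp_pos _), ← sq_abs x]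
  have h1 : (|x| / 3 + 1) ^ 3 ≤ Real.exp |x| := by
    have := pow_le_pow_left₀ (by positivity) (Real.add_one_le_exp (|x| / 3)) 3
    rw [← Real.exp_nat_mul] at this
    have e : ((3 : ℕ) : ℝ) * (|x| / 3) = |x| := by push_cast; ring
    rwa [e] at this
  nlinarith [pow_nonneg hx 2, pow_nonneg hx 3]

section weight
variable {w : ℝ → ℝ} {K : ℝ} {f : ℝ → ℂ} {M : ℝ}

lemma weight_bound (hw : ∀ x, |w x| ≤ K * Real.exp (-|x|))
    (hM : ∀ x, ‖f x‖ ≤ M * (1 + |x|)) (x : ℝ) :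
    ‖f x * (w x : ℂ)‖ ≤ M * K * ((1 + |x|) * Real.exp (-|x|)) := by
  rw [norm_mul, Complex.norm_real, Real.norm_eq_abs]
  calc ‖f x‖ * |w x| ≤ (M * (1 + |x|)) * (K * Real.exp (-|x|)) :=
        mul_le_mul (hM x) (hw x) (abs_nonneg _) ((norm_nonneg _).trans (hM x))
    _ = _ := by ring

lemma weight_integrable (hwm : Measurable w) (hw : ∀ x, |w x| ≤ K * Real.exp (-|x|))
    (hf : Continuous f) (hM : ∀ x, ‖f x‖ ≤ M * (1 + |x|)) :
    Integrable (fun x => f x * (w x : ℂ)) := by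
  refine (integrable_g.const_mul (M * K)).mono' ?_
    (Filter.Eventually.of_forall fun x => weight_bound hw hM x)
  exact (hf.measurable.mul (Complex.measurable_ofReal.comp hwm)).aestronglyMeasurable

lemma weight_norm_le (hw : ∀ x, |w x| ≤ K * Real.exp (-|x|))
    (hM : ∀ x, ‖f x‖ ≤ M * (1 + |x|)) :
    ‖∫ x, f x * (w x : ℂ)‖ ≤ M * K * ∫ x, (1 + |x|) * Real.exp (-|x|) := by
  rw [← integral_const_mul]
  exact norm_integral_le_of_norm_le (integrable_g.const_mul (M * K))
    (Filter.Eventually.of_forall fun x => weight_bound hw hM x)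

lemma shift_bound (hM0 : 0 ≤ M) (hM : ∀ x, ‖f x‖ ≤ M * (1 + |x|)) {β : ℝ}
    (hβ : β ∈ Icc (-1 : ℝ) 1) (x : ℝ) : ‖f (x + β)‖ ≤ (2 * M) * (1 + |x|) := by
  refine (hM _).trans ?_
  have h1 := abs_add_le x β
  have h2 : |β| ≤ 1 := abs_le.2 hβ
  have := abs_nonneg x
  nlinarith

lemma weight_continuousOn (hwm : Measurable w) (hw : ∀ x, |w x| ≤ K * Real.exp (-|x|))
    (hf : Continuous f) (hM0 : 0 ≤ M) (hM : ∀ x, ‖f x‖ ≤ M * (1 + |x|)) :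
    ContinuousOn (fun β => ∫ x, f (x + β) * (w x : ℂ)) (Icc (-1) 1) := by
  refine continuousOn_of_dominated (bound := fun x => (2 * M) * K * ((1 + |x|) * Real.exp (-|x|)))
    ?_ ?_ (integrable_g.const_mul _) ?_
  · intro β hβ
    exact (weight_integrable hwm hw (f := fun x => f (x + β)) (by fun_prop)
      (shift_bound hM0 hM hβ)).aestronglyMeasurable
  · intro β hβ
    exact Filter.Eventually.of_forall fun x =>
      weight_bound (f := fun x => f (x + β)) hw (shift_bound hM0 hM hβ) x
  · refine Filter.Eventually.of_forall fun x => ?_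
    exact Continuous.continuousOn (by fun_prop)

end weight

/-! ### Pointwise control of the perturbation -/

lemma pointwise_bound {R δ : ℝ} (hδ : 0 < δ) {χ : ℝ → ℂ} (hχ : Differentiable ℝ χ)
    (h : rho R χ ≤ ENNReal.ofReal (δ ^ 2)) (x : ℝ) :
    ‖χ x - (φ x : ℂ)‖ ≤ δ * (3 + |R|) * (1 + |x|) := by
  set η : ℝ → ℂ := fun x => χ x - (φ x : ℂ) with hη
  have hder : ∀ x, HasDerivAt η (deriv χ x - ((deriv φ x : ℝ) : ℂ)) x := fun x =>
    (hχ x).hasDerivAt.sub ((deriv_phi x ▸ hasDerivAt_phi x : HasDerivAt φ (deriv φ x) x).ofReal_comp)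
  have hηc : Continuous η := continuous_iff_continuousAt.2 fun x => (hder x).continuousAt
  set d : ℝ → ℂ := fun x => deriv χ x - ((deriv φ x : ℝ) : ℂ) with hd
  have hdm : Measurable d :=
    (measurable_deriv χ).sub (Complex.measurable_ofReal.comp (measurable_deriv φ))
  have e1 : ∫⁻ x, (‖d x‖₊ : ℝ≥0∞) ^ 2 ≤ ENNReal.ofReal (δ ^ 2) :=
    (le_self_add.trans le_self_add).trans h
  have e2 : ∫⁻ x, ENNReal.ofReal (W R x) * (‖η x‖₊ : ℝ≥0∞) ^ 2 ≤ ENNReal.ofReal (δ ^ 2) :=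
    (le_add_self.trans le_self_add).trans h
  have hsq : ∀ z : ℂ, (‖z‖₊ : ℝ≥0∞) ^ 2 = ENNReal.ofReal (‖z‖ ^ 2) := by
    intro z
    rw [ENNReal.ofReal_pow (norm_nonneg _), ofReal_norm]; rfl
  -- a good point
  obtain ⟨y, hy, hyη⟩ : ∃ y ∈ Icc (R - 1) R, ‖η y‖ ≤ δ := by
    by_contra! hcon
    obtain ⟨y0, hy0, hmin⟩ := isCompact_Icc.exists_isMinOn (s := Icc (R - 1) R)
      (nonempty_Icc.2 (by linarith)) hηc.norm.continuousOn
    have h1 : ENNReal.ofReal (‖η y0‖ ^ 2) ≤ ENNReal.ofReal (δ ^ 2) := by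
      calc ENNReal.ofReal (‖η y0‖ ^ 2)
          = ∫⁻ x in Icc (R - 1) R, ENNReal.ofReal (‖η y0‖ ^ 2) := by
            rw [setLIntegral_const]; simp
        _ ≤ ∫⁻ x in Icc (R - 1) R, ENNReal.ofReal (W R x) * (‖η x‖₊ : ℝ≥0∞) ^ 2 := by
            refine setLIntegral_mono' measurableSet_Icc fun x hx => ?_
            rw [W, if_pos hx.2, ENNReal.ofReal_one, one_mul, hsq]
            exact ENNReal.ofReal_le_ofReal (pow_le_pow_left₀ (norm_nonneg _) (hmin hx) 2)
        _ ≤ _ := (setLIntegral_le_lintegral _ _).trans e2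
    rw [ENNReal.ofReal_le_ofReal_iff (by positivity)] at h1
    have := hcon y0 hy0
    nlinarith
  -- square integrability of the derivative
  have hint : Integrable (fun x => ‖d x‖ ^ 2) := by
    refine ⟨(hdm.norm.pow_const 2).aestronglyMeasurable, ?_⟩
    rw [hasFiniteIntegral_iff_ofReal (Filter.Eventually.of_forall fun x => by positivity)]
    simp_rw [← hsq]
    exact e1.trans_lt ENNReal.ofReal_lt_top
  have hintle : ∫ x, ‖d x‖ ^ 2 ≤ δ ^ 2 := by
    rw [integral_eq_lintegral_of_nonneg_ae (Filter.Eventually.of_forall fun x => by positivity)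
      hint.aestronglyMeasurable]
    simp_rw [← hsq]
    exact ENNReal.toReal_le_of_le_ofReal (by positivity) e1
  have hpt : ∀ x, ‖d x‖ ≤ (δ + ‖d x‖ ^ 2 / δ) := by
    intro x
    have h1 : 0 ≤ ‖d x‖ := norm_nonneg _
    have h2 : ‖d x‖ ^ 2 / δ * δ = ‖d x‖ ^ 2 := by field_simp
    have : ‖d x‖ * δ ≤ (δ + ‖d x‖ ^ 2 / δ) * δ := by
      rw [add_mul, h2]; nlinarith [sq_nonneg (‖d x‖ - δ)]
    exact le_of_mul_le_mul_right this hδ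
  have hbi : ∀ a b : ℝ, IntegrableOn (fun x => δ + ‖d x‖ ^ 2 / δ) (uIoc a b) := fun a b =>
    (integrableOn_const (by simp [uIoc])).add (hint.div_const δ).integrableOn
  have hdi : IntervalIntegrable d volume y x := by
    rw [intervalIntegrable_iff]
    exact (hbi y x).mono' hdm.aestronglyMeasurable (Filter.Eventually.of_forall hpt)
  have hftc : ∫ t in y..x, d t = η x - η y :=
    intervalIntegral.integral_eq_sub_of_hasDerivAt (fun t _ => hder t) hdi
  have hdiff : ‖η x - η y‖ ≤ δ * |x - y| + δ := by
    rw [← hftc]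
    refine (intervalIntegral.norm_integral_le_integral_norm_uIoc).trans ?_
    calc ∫ t in uIoc y x, ‖d t‖ ≤ ∫ t in uIoc y x, (δ + ‖d t‖ ^ 2 / δ) :=
          integral_mono_of_nonneg (Filter.Eventually.of_forall fun t => norm_nonneg _) (hbi y x)
            (Filter.Eventually.of_forall hpt)
      _ = δ * |x - y| + (∫ t in uIoc y x, ‖d t‖ ^ 2) / δ := by
          have i0 : Integrable (fun _ : ℝ => δ) (volume.restrict (uIoc y x)) :=
            integrableOn_const (by simp [uIoc])
          rw [integral_add i0 (hint.div_const δ).integrableOn,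
            integral_div, setIntegral_const]
          congr 1
          rw [smul_eq_mul, mul_comm, Measure.real, Real.volume_uIoc,
            ENNReal.toReal_ofReal (abs_nonneg _)]
      _ ≤ _ := by
          gcongr
          rw [div_le_iff₀ hδ, ← sq]
          exact (setIntegral_le_integral hint
            (Filter.Eventually.of_forall fun x => by positivity)).trans hintle
  have h3 : ‖η x‖ ≤ ‖η x - η y‖ + ‖η y‖ := by simpa using norm_add_le (η x - η y) (η y)
  have h4 : |x - y| ≤ |x| + |R| + 1 := by
    have a1 := le_abs_self x
    have a2 := neg_abs_le x
    have a3 := le_abs_self R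
    have a4 := neg_abs_le R
    rw [abs_le]; constructor <;> linarith [hy.1, hy.2]
  have h5 : ‖η x‖ ≤ δ * (|x| + |R| + 3) := by nlinarith
  refine h5.trans ?_
  rw [mul_assoc]
  refine mul_le_mul_of_nonneg_left ?_ hδ.le
  nlinarith [abs_nonneg x, abs_nonneg R, mul_nonneg (abs_nonneg x) (abs_nonneg R)]

/-! ### The main argument -/

lemma phi_c_bound (x : ℝ) : ‖((φ x : ℝ) : ℂ)‖ ≤ 1 * (1 + |x|) := by
  rw [Complex.norm_real, Real.norm_of_nonneg (phi_pos x).le]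
  linarith [phi_lt_one x, abs_nonneg x]

lemma continuous_phi_c : Continuous (fun x => ((φ x : ℝ) : ℂ)) :=
  Complex.continuous_ofReal.comp continuous_phi

lemma integrable_phi_shift {w : ℝ → ℝ} {K : ℝ} (hwm : Measurable w)
    (hw : ∀ x, |w x| ≤ K * Real.exp (-|x|)) (β : ℝ) :
    Integrable (fun x => φ (x + β) * w x) := by
  have h := weight_integrable (f := fun x => ((φ (x + β) : ℝ) : ℂ)) (M := 1) hwm hw
    (continuous_phi_c.comp (continuous_add_const β)) (fun x => by
      rw [Complex.norm_real, Real.norm_of_nonneg (phi_pos _).le]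
      linarith [phi_lt_one (x + β), abs_nonneg x])
  simpa using h.re

lemma strict_integral {w : ℝ → ℝ} {K : ℝ} (hwm : Measurable w) (hpos : ∀ x, 0 < w x)
    (hw : ∀ x, |w x| ≤ K * Real.exp (-|x|)) :
    StrictMono (fun β => ∫ x, φ (x + β) * w x) := by
  intro a b hab
  have h : 0 < ∫ x, (φ (x + b) * w x - φ (x + a) * w x) := by
    have hp : ∀ x, 0 < φ (x + b) * w x - φ (x + a) * w x := fun x => by
      have := phi_strictMono (show x + a < x + b by linarith)
      nlinarith [hpos x]
    rw [integral_pos_iff_support_of_nonneg (fun x => (hp x).le)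
      ((integrable_phi_shift hwm hw b).sub (integrable_phi_shift hwm hw a))]
    have : Function.support (fun x => φ (x + b) * w x - φ (x + a) * w x) = univ := by
      ext x; simpa using (hp x).ne'
    rw [this]; simp
  rw [integral_sub (integrable_phi_shift hwm hw b) (integrable_phi_shift hwm hw a)] at h
  simpa using h

lemma diff_bound {w : ℝ → ℝ} {K : ℝ} (hwm : Measurable w)
    (hw : ∀ x, |w x| ≤ K * Real.exp (-|x|)) {χ : ℝ → ℂ} (hχ : Continuous χ) {M : ℝ}
    (hM0 : 0 ≤ M) (hM : ∀ x, ‖χ x - (φ x : ℂ)‖ ≤ M * (1 + |x|)) {β : ℝ}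
    (hβ : β ∈ Icc (-1 : ℝ) 1) :
    ‖(∫ x, χ (x + β) * (w x : ℂ)) - ((∫ x, φ (x + β) * w x : ℝ) : ℂ)‖ ≤
      2 * M * K * ∫ x, (1 + |x|) * Real.exp (-|x|) := by
  have hηc : Continuous fun x => χ x - (φ x : ℂ) := hχ.sub continuous_phi_c
  have i1 := weight_integrable hwm hw (f := fun x => χ (x + β) - (φ (x + β) : ℂ))
    (hηc.comp (continuous_add_const β)) (shift_bound (f := fun x => χ x - (φ x : ℂ)) hM0 hM hβ)
  have i2 : Integrable (fun x => ((φ (x + β) * w x : ℝ) : ℂ)) :=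
    (integrable_phi_shift hwm hw β).ofReal
  have e : ∫ x, χ (x + β) * (w x : ℂ) =
      (∫ x, (χ (x + β) - (φ (x + β) : ℂ)) * (w x : ℂ)) + ((∫ x, φ (x + β) * w x : ℝ) : ℂ) := by
    rw [← integral_complex_ofReal, ← integral_add i1 i2]
    congr 1; funext x; push_cast; ring
  rw [e, add_sub_cancel_right]
  exact weight_norm_le hw (shift_bound (f := fun x => χ x - (φ x : ℂ)) hM0 hM hβ)

lemma open_aux (P : ℂ × ℂ → Prop) (hP : IsOpen {p | P p}) (a b : ℝ) (h : P ((a : ℂ), (b : ℂ))) :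
    ∃ κ > 0, ∀ z t : ℂ, ‖z - a‖ < κ → ‖t - b‖ < κ → P (z, t) := by
  obtain ⟨κ, hκ, hb⟩ := Metric.isOpen_iff.1 hP _ h
  refine ⟨κ, hκ, fun z t hz ht => hb ?_⟩
  rw [Metric.mem_ball, Prod.dist_eq, dist_eq_norm, dist_eq_norm]
  exact max_lt hz ht

theorem decomposition_near_kink (R : ℝ) :
    ∃ ε₀ > (0 : ℝ), ∀ ψ : ℝ → ℂ, Differentiable ℝ ψ →
      (∀ K : Set ℝ, IsCompact K → IntegrableOn (fun x => ‖deriv ψ x‖ ^ 2) K) →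
      Integrable (fun x => W R x * ‖ψ x - (φ x : ℂ)‖ ^ 2) →
      (⨅ (α : ℝ) (β : ℝ),
          rho R (fun x => Complex.exp (Complex.I * (α : ℂ)) * ψ (x + β))) ≤
        ENNReal.ofReal (ε₀ ^ 2) →
      ∃ α β : ℝ,
        (∫ x : ℝ,
          ((Complex.exp (Complex.I * (α : ℂ)) * ψ (x + β)).re - φ x) * deriv φ x) = 0 ∧
        (∫ x : ℝ,
          W R x * (Complex.exp (Complex.I * (α : ℂ)) * ψ (x + β)).im * φ x) = 0 := by
  set w₁ : ℝ → ℝ := deriv φ with hw₁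
  set w₂ : ℝ → ℝ := fun x => W R x * φ x with hw₂
  set K : ℝ := 1 + (Real.exp |R| + 1 / (1 - φ R ^ 2)) with hK
  have hR : 0 < 1 - φ R ^ 2 := by linarith [phi_sq_lt R]
  have hc0 : 0 < Real.exp |R| + 1 / (1 - φ R ^ 2) := by positivity
  have m₁ : Measurable w₁ := measurable_deriv φ
  have m₂ : Measurable w₂ := (measurable_W R).mul continuous_phi.measurable
  have p₁ : ∀ x, 0 < w₁ x := deriv_phi_pos
  have p₂ : ∀ x, 0 < w₂ x := fun x => mul_pos (W_pos R x) (phi_pos x)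
  have b₁ : ∀ x, |w₁ x| ≤ K * Real.exp (-|x|) := fun x => by
    rw [abs_of_pos (p₁ x)]
    have := deriv_phi_le x
    have h2 := mul_pos hc0 (Real.exp_pos (-|x|))
    rw [hK, add_mul]; linarith
  have b₂ : ∀ x, |w₂ x| ≤ K * Real.exp (-|x|) := fun x => by
    rw [abs_of_pos (p₂ x)]
    have := W_phi_le R x
    rw [hK, add_mul]; linarith [Real.exp_pos (-|x|)]
  set J : ℝ := ∫ x, (1 + |x|) * Real.exp (-|x|) with hJ
  have hJ0 : 0 ≤ J := integral_nonneg fun x => by positivity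
  set A₀ : ℝ → ℝ := fun β => ∫ x, φ (x + β) * w₁ x with hA₀
  set B₀ : ℝ → ℝ := fun β => ∫ x, φ (x + β) * w₂ x with hB₀
  have sA : StrictMono A₀ := strict_integral m₁ p₁ b₁
  have sB : StrictMono B₀ := strict_integral m₂ p₂ b₂
  have B₀nn : ∀ β, 0 ≤ B₀ β := fun β =>
    integral_nonneg fun x => (mul_pos (phi_pos _) (p₂ x)).le
  have B₀pos : ∀ β, 0 < B₀ β := fun β => (B₀nn (β - 1)).trans_lt (sB (by linarith))
  set c : ℝ := A₀ 0 with hc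
  let Φ : ℂ × ℂ → ℝ := fun p => ((starRingEnd ℂ) p.2 * p.1).re - c * ‖p.2‖
  have hΦ : Continuous Φ := by
    have : Continuous fun p : ℂ × ℂ => (starRingEnd ℂ) p.2 := Complex.continuous_conj.comp continuous_snd
    exact (Complex.continuous_re.comp (this.mul continuous_fst)).sub
      (continuous_const.mul continuous_snd.norm)
  have hΦr : ∀ a b : ℝ, 0 < b → Φ ((a : ℂ), (b : ℂ)) = b * (a - c) := fun a b hb => by
    simp only [Φ, Complex.conj_ofReal, Complex.norm_real, Real.norm_of_nonneg hb.le]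
    rw [← Complex.ofReal_mul, Complex.ofReal_re]; ring
  obtain ⟨κ₁, hκ₁, H₁⟩ := open_aux (fun p => 0 < Φ p) (isOpen_lt continuous_const hΦ)
    (A₀ 1) (B₀ 1) (by
      rw [hΦr _ _ (B₀pos 1)]
      exact mul_pos (B₀pos 1) (sub_pos.2 (sA (by norm_num))))
  obtain ⟨κ₂, hκ₂, H₂⟩ := open_aux (fun p => Φ p < 0) (isOpen_lt hΦ continuous_const)
    (A₀ (-1)) (B₀ (-1)) (by
      rw [hΦr _ _ (B₀pos (-1))]
      exact mul_neg_of_pos_of_neg (B₀pos (-1)) (sub_neg.2 (sA (by norm_num))))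
  obtain ⟨κ, hκ, k1, k2, k3⟩ : ∃ κ > 0, κ ≤ κ₁ ∧ κ ≤ κ₂ ∧ κ ≤ B₀ (-1) :=
    ⟨min κ₁ (min κ₂ (B₀ (-1))), lt_min hκ₁ (lt_min hκ₂ (B₀pos _)), min_le_left _ _,
      (min_le_right _ _).trans (min_le_left _ _), (min_le_right _ _).trans (min_le_right _ _)⟩
  set C : ℝ := 2 * (3 + |R|) * K * J with hC
  have hK0 : 0 < K := by rw [hK]; linarith
  have hC0 : 0 ≤ C := by positivity
  set δ : ℝ := κ / (C + 1) with hδ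
  have hδ0 : 0 < δ := by positivity
  have hδC : δ * C < κ := by
    rw [hδ, div_mul_eq_mul_div, div_lt_iff₀ (by positivity)]; nlinarith
  refine ⟨δ / 2, by positivity, fun ψ hψ _ _ hinf => ?_⟩
  obtain ⟨α₀, β₀, hrho⟩ : ∃ α β : ℝ,
      rho R (fun x => Complex.exp (Complex.I * (α : ℂ)) * ψ (x + β)) < ENNReal.ofReal (δ ^ 2) := by
    have : (⨅ (α : ℝ) (β : ℝ), rho R (fun x => Complex.exp (Complex.I * (α : ℂ)) * ψ (x + β))) <
        ENNReal.ofReal (δ ^ 2) := by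
      refine hinf.trans_lt ((ENNReal.ofReal_lt_ofReal_iff (by positivity)).2 ?_)
      nlinarith
    simpa only [iInf_lt_iff] using this
  set χ : ℝ → ℂ := fun x => Complex.exp (Complex.I * (α₀ : ℂ)) * ψ (x + β₀) with hχ
  have χd : Differentiable ℝ χ := by
    have : Differentiable ℝ fun x => ψ (x + β₀) := hψ.comp (differentiable_id.add_const β₀)
    exact this.const_mul _
  have χc := χd.continuous
  have hpb := pointwise_bound hδ0 χd hrho.le
  have hM0 : 0 ≤ δ * (3 + |R|) := by positivity
  have hχb : ∀ x, ‖χ x‖ ≤ (δ * (3 + |R|) + 1) * (1 + |x|) := fun x => by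
    have h1 := norm_add_le (χ x - (φ x : ℂ)) (φ x : ℂ)
    rw [sub_add_cancel] at h1
    have := hpb x
    have := phi_c_bound x
    rw [add_mul]; linarith
  set A : ℝ → ℂ := fun β => ∫ x, χ (x + β) * (w₁ x : ℂ) with hA
  set B : ℝ → ℂ := fun β => ∫ x, χ (x + β) * (w₂ x : ℂ) with hB
  have cA : ContinuousOn A (Icc (-1) 1) := weight_continuousOn m₁ b₁ χc (by positivity) hχb
  have cB : ContinuousOn B (Icc (-1) 1) := weight_continuousOn m₂ b₂ χc (by positivity) hχb
  have eC : 2 * (δ * (3 + |R|)) * K * J = δ * C := by rw [hC]; ring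
  have dA : ∀ β ∈ Icc (-1 : ℝ) 1, ‖A β - A₀ β‖ < κ := fun β hβ =>
    (diff_bound m₁ b₁ χc hM0 hpb hβ).trans_lt (by rw [← hJ, eC]; exact hδC)
  have dB : ∀ β ∈ Icc (-1 : ℝ) 1, ‖B β - B₀ β‖ < κ := fun β hβ =>
    (diff_bound m₂ b₂ χc hM0 hpb hβ).trans_lt (by rw [← hJ, eC]; exact hδC)
  have l1 : (1 : ℝ) ∈ Icc (-1 : ℝ) 1 := by simp
  have l2 : (-1 : ℝ) ∈ Icc (-1 : ℝ) 1 := by simp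
  have v1 : 0 < Φ (A 1, B 1) := H₁ _ _ ((dA 1 l1).trans_le k1) ((dB 1 l1).trans_le k1)
  have v2 : Φ (A (-1), B (-1)) < 0 :=
    H₂ _ _ ((dA _ l2).trans_le k2) ((dB _ l2).trans_le k2)
  have cΦ : ContinuousOn (fun β => Φ (A β, B β)) (Icc (-1) 1) :=
    hΦ.comp_continuousOn (cA.prodMk cB)
  obtain ⟨β, hβ, hroot⟩ := intermediate_value_Icc (by norm_num) cΦ ⟨v2.le, v1.le⟩
  have hBne : B β ≠ 0 := fun h0 => by
    have h1 := dB β hβ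
    rw [h0, zero_sub, norm_neg, Complex.norm_real, Real.norm_of_nonneg (B₀nn β)] at h1
    have := sB.monotone hβ.1
    linarith
  set θ : ℝ := -(B β).arg with hθ
  set u : ℂ := Complex.exp (Complex.I * (θ : ℂ)) with hu
  have hBn : (0 : ℝ) < ‖B β‖ := norm_pos_iff.2 hBne
  have huB : u * B β = (‖B β‖ : ℂ) := by
    conv_lhs => rw [← Complex.norm_mul_exp_arg_mul_I (B β)]
    rw [mul_left_comm, hu, ← Complex.exp_add, hθ]
    have : Complex.I * ((-(B β).arg : ℝ) : ℂ) + ((B β).arg : ℂ) * Complex.I = 0 := by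
      push_cast; ring
    rw [this, Complex.exp_zero, mul_one]
  have huc : (‖B β‖ : ℂ) * u = (starRingEnd ℂ) (B β) := by
    have h1 : (starRingEnd ℂ) (B β) * B β = (‖B β‖ : ℂ) * (‖B β‖ : ℂ) := by
      rw [mul_comm, Complex.mul_conj, Complex.normSq_eq_norm_sq]; push_cast; ring
    apply mul_right_cancel₀ hBne
    rw [h1, mul_assoc, huB]
  have hreA : (u * A β).re = c := by
    have h1 : ((starRingEnd ℂ) (B β) * A β).re - c * ‖B β‖ = 0 := hroot
    rw [← huc, mul_assoc, Complex.re_ofReal_mul] at h1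
    have : ‖B β‖ * ((u * A β).re - c) = 0 := by linarith
    rcases mul_eq_zero.1 this with h | h
    · exact absurd h hBn.ne'
    · linarith
  have himB : (u * B β).im = 0 := by rw [huB, Complex.ofReal_im]
  have hχs : ∀ x, Complex.exp (Complex.I * ((θ + α₀ : ℝ) : ℂ)) * ψ (x + (β + β₀)) =
      u * χ (x + β) := fun x => by
    rw [hχ, hu]
    simp only
    rw [← mul_assoc, ← Complex.exp_add, add_assoc]
    congr 2; push_cast; ring
  have hM1 : 0 ≤ δ * (3 + |R|) + 1 := by positivity
  have iA := (weight_integrable m₁ b₁ (f := fun x => χ (x + β))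
    (χc.comp (continuous_add_const β)) (shift_bound hM1 hχb hβ)).const_mul u
  have iB := (weight_integrable m₂ b₂ (f := fun x => χ (x + β))
    (χc.comp (continuous_add_const β)) (shift_bound hM1 hχb hβ)).const_mul u
  refine ⟨θ + α₀, β + β₀, ?_, ?_⟩
  · have e : ∀ x, ((Complex.exp (Complex.I * ((θ + α₀ : ℝ) : ℂ)) * ψ (x + (β + β₀))).re - φ x) *
        w₁ x = RCLike.re (u * (χ (x + β) * (w₁ x : ℂ))) - φ (x + 0) * w₁ x := fun x => by
      rw [hχs, ← mul_assoc u (χ (x + β)), mul_comm (u * χ (x + β)), RCLike.re_eq_complex_re,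
        Complex.re_ofReal_mul, add_zero]
      ring
    simp_rw [e]
    rw [integral_sub iA.re (integrable_phi_shift m₁ b₁ 0), integral_re iA, integral_const_mul]
    exact sub_eq_zero.2 hreA
  · have e : ∀ x, W R x * (Complex.exp (Complex.I * ((θ + α₀ : ℝ) : ℂ)) *
        ψ (x + (β + β₀))).im * φ x = RCLike.im (u * (χ (x + β) * (w₂ x : ℂ))) := fun x => by
      rw [hχs, ← mul_assoc u (χ (x + β)), mul_comm (u * χ (x + β)), RCLike.im_eq_complex_im,
        Complex.im_ofReal_mul]
      ring
    simp_rw [e]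
    rw [integral_im iB, integral_const_mul]
    exact himB
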